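/- Let Q be a strictly sign-coherent ice quiver on n mutable vertices whose mutable subquiver is a fork F with point of return r, and let v_1 ≺ v_2 ≺ ... ≺ v_{n-1} be the unique acyclic ordering of F \ {r}. Suppose r and v_j are the only two green vertices of Q (all other mutable vertices are red). Then there exists a mutation sequence of length at most j+2 taking Q to an ice quiver whose mutable subquiver is a fork and which has at least n-1 red vertices. -/

import Mathlib

open Matrix

section QuiverDefs

variable {V W : Type*}

/-- Mutation of an exchange matrix at the vertex `k`. -/
def mutB [DecidableEq V] (B : Matrix V V ℤ) (k : V) : Matrix V V ℤ :=
  Matrix.of fun i j =>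
    if i = k ∨ j = k then -B i j else B i j + (B i k).sign * max (B i k * B k j) 0

/-- Mutation of the `C`-matrix of an extended exchange matrix `[B | C]` at the vertex `k`. -/
def mutC [DecidableEq V] (B : Matrix V V ℤ) (C : Matrix V W ℤ) (k : V) : Matrix V W ℤ :=
  Matrix.of fun i j =>
    if i = k then -C i j else C i j + (B i k).sign * max (B i k * C k j) 0

/-- One mutation step on an extended exchange matrix `[B | C]`, regarded as a pair `(B, C)`. -/
def mutPair [DecidableEq V] (P : Matrix V V ℤ × Matrix V W ℤ) (k : V) :
    Matrix V V ℤ × Matrix V W ℤ :=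
  (mutB P.1 k, mutC P.1 P.2 k)

/-- Iterated mutation of an extended exchange matrix along a list of mutable vertices. -/
def mutSeqPair [DecidableEq V] (P : Matrix V V ℤ × Matrix V W ℤ) (w : List V) :
    Matrix V V ℤ × Matrix V W ℤ :=
  w.foldl mutPair P

/-- Iterated mutation of an exchange matrix along a list of vertices. -/
def mutSeqB [DecidableEq V] (B : Matrix V V ℤ) (w : List V) : Matrix V V ℤ :=
  w.foldl mutB B

/-- A quiver is abundant if there are at least two arrows between any two distinct vertices. -/
def QAbundant (B : Matrix V V ℤ) : Prop := ∀ i j, i ≠ j → 2 ≤ |B i j|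

/-- There is a directed cycle of the quiver `B` all of whose vertices lie in `S`. -/
def HasCycleIn (B : Matrix V V ℤ) (S : Set V) : Prop :=
  ∃ (x : V) (l : List V), x ∈ S ∧ (∀ y ∈ l, y ∈ S) ∧
    List.Chain (fun i j => 0 < B i j) x (l ++ [x])

/-- A quiver is acyclic if it has no directed cycle. -/
def QAcyclic (B : Matrix V V ℤ) : Prop := ¬ HasCycleIn B Set.univ

/-- The vertex `x` is a source: all arrows at `x` point away from `x`. -/
def QSource (B : Matrix V V ℤ) (x : V) : Prop := ∀ j, 0 ≤ B x j

/-- The vertex `x` is a sink: all arrows at `x` point into `x`. -/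
def QSink (B : Matrix V V ℤ) (x : V) : Prop := ∀ j, B x j ≤ 0

/-- `B` is a fork with point of return `r`: it is abundant, not acyclic, the full subquiver
obtained by deleting `r` is acyclic, and for all `i` with `i → r` and `j` with `r → j` one has
`b_{ji} > b_{ir}` and `b_{ji} > b_{rj}`. -/
def QFork (B : Matrix V V ℤ) (r : V) : Prop :=
  QAbundant B ∧ ¬ QAcyclic B ∧ ¬ HasCycleIn B {x | x ≠ r} ∧
    ∀ i j, 0 < B i r → 0 < B r j → B i r < B j i ∧ B r j < B j i

/-- The mutable vertex `i` is green: its `c`-vector is nonzero with all entries `≥ 0`. -/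
def QGreen (C : Matrix V W ℤ) (i : V) : Prop := (∀ j, 0 ≤ C i j) ∧ C i ≠ 0

/-- The mutable vertex `i` is red: its `c`-vector is nonzero with all entries `≤ 0`. -/
def QRed (C : Matrix V W ℤ) (i : V) : Prop := (∀ j, C i j ≤ 0) ∧ C i ≠ 0

/-- The mutable vertex `i` is blue: its `c`-vector is zero. -/
def QBlue (C : Matrix V W ℤ) (i : V) : Prop := C i = 0

/-- `i` has the same color (red/green/blue) with respect to `C` and to `C'`. -/
def SameColorQ (C C' : Matrix V W ℤ) (i : V) : Prop :=
  (QRed C i ↔ QRed C' i) ∧ (QGreen C i ↔ QGreen C' i) ∧ (QBlue C i ↔ QBlue C' i)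

/-- The `c`-vectors of `i` and `j` have the same sign (`sgn(c_i) = sgn(c_j)`). -/
def SameSignQ (C : Matrix V W ℤ) (i j : V) : Prop :=
  (QGreen C i ∧ QGreen C j) ∨ (QRed C i ∧ QRed C j)

/-- The `c`-vectors of `i` and `j` have opposite signs (`sgn(c_i) = -sgn(c_j)`). -/
def OppSignQ (C : Matrix V W ℤ) (i j : V) : Prop :=
  (QGreen C i ∧ QRed C j) ∨ (QRed C i ∧ QGreen C j)

/-- An ice quiver is uniformly sign-coherent if after every mutation sequence every mutable
vertex is red, green, or blue, and not every mutable vertex of the initial quiver is blue. -/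
def USC [DecidableEq V] (P : Matrix V V ℤ × Matrix V W ℤ) : Prop :=
  (∀ (w : List V) (i : V),
      QRed (mutSeqPair P w).2 i ∨ QGreen (mutSeqPair P w).2 i ∨ QBlue (mutSeqPair P w).2 i) ∧
    ¬ ∀ i, QBlue P.2 i

/-- An ice quiver is strictly sign-coherent if after every mutation sequence every mutable
vertex is red or green. -/
def SSC [DecidableEq V] (P : Matrix V V ℤ × Matrix V W ℤ) : Prop :=
  ∀ (w : List V) (i : V), QRed (mutSeqPair P w).2 i ∨ QGreen (mutSeqPair P w).2 i

/-- The four sign conditions at the distinguished vertex `r`: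
(1) every mutable vertex is red or green;
(2) if every entry of `b_{rj}·c_j` is `≥ 0` for some `j ≠ r`, then `sgn(c_j) = sgn(c_r)` or
    `sgn(c_j)·c_j ≥ sgn(c_r)·c_r` entrywise (i.e. `|c_r| ≤ |c_j|` entrywise);
(3) if every entry of `b_{rj}·c_j` is `≤ 0` for some `j ≠ r`, then `sgn(c_j) = -sgn(c_r)`;
(4) if every entry of `b_{ij}·c_j` is `≥ 0` for distinct `i, j` both `≠ r`,
    then `sgn(c_i) = sgn(c_j)`. -/
def FourConds (Bw : Matrix V V ℤ) (Cw : Matrix V W ℤ) (r : V) : Prop :=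
  (∀ i, QRed Cw i ∨ QGreen Cw i) ∧
  (∀ j, j ≠ r → (∀ t, 0 ≤ Bw r j * Cw j t) →
    (SameSignQ Cw j r ∨ ∀ t, |Cw r t| ≤ |Cw j t|)) ∧
  (∀ j, j ≠ r → (∀ t, Bw r j * Cw j t ≤ 0) → OppSignQ Cw j r) ∧
  (∀ i j, i ≠ j → i ≠ r → j ≠ r → (∀ t, 0 ≤ Bw i j * Cw j t) → SameSignQ Cw i j)

end QuiverDefs

section Helpers

variable {V W : Type*} [DecidableEq V]

/-- A convenient reformulation of being a fork: acyclicity is replaced by transitivity. -/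
structure FK (B : Matrix V V ℤ) (p : V) : Prop where
  skew : ∀ i j, B j i = -B i j
  abd : ∀ i j, i ≠ j → 2 ≤ B i j ∨ 2 ≤ B j i
  trans : ∀ x y z, x ≠ p → y ≠ p → z ≠ p → 0 < B x y → 0 < B y z → 0 < B x z
  ineq : ∀ i j, 0 < B i p → 0 < B p j → B i p < B j i ∧ B p j < B j i
  hin : ∃ i, 0 < B i p
  hout : ∃ j, 0 < B p j

theorem chain_pos {B : Matrix V V ℤ} {p : V} (h : FK B p) :
    ∀ (l : List V) (x z : V), x ≠ p → z ≠ p → (∀ y ∈ l, y ≠ p) →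
      List.IsChain (fun i j => 0 < B i j) (x :: (l ++ [z])) → 0 < B x z := by
  intro l
  induction l with
  | nil => intro x z _ _ _ hc; simpa using hc
  | cons a l ih =>
    intro x z hx hz hl hc
    simp only [List.cons_append, List.isChain_cons_cons] at hc
    have ha : a ≠ p := hl a (by simp)
    exact h.trans x a z hx ha hz hc.1
      (ih a z ha hz (fun y hy => hl y (by simp [hy])) hc.2)

theorem FK.toQFork {B : Matrix V V ℤ} {p : V} (h : FK B p) : QFork B p := by
  refine ⟨?_, ?_, ?_, h.ineq⟩
  · intro i j hij
    have := h.skew i j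
    rcases h.abd i j hij with h1 | h1
    · exact le_trans h1 (le_abs_self _)
    · rw [le_abs]; right; omega
  · intro hac
    apply hac
    obtain ⟨i, hi⟩ := h.hin
    obtain ⟨j, hj⟩ := h.hout
    have := h.ineq i j hi hj
    refine ⟨p, [j, i], trivial, fun _ _ => trivial, ?_⟩
    simp [List.Chain]
    exact ⟨hj, by omega, hi⟩
  · rintro ⟨x, l, hx, hl, hc⟩
    have h1 := chain_pos h l x x hx hx hl hc
    have := h.skew x x
    omega

theorem FK.total {B : Matrix V V ℤ} {p : V} (h : FK B p) {x y : V} (hxy : x ≠ y) :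
    0 < B x y ∨ 0 < B y x := by
  rcases h.abd x y hxy with h | h
  · left; omega
  · right; omega

theorem FK.of_not_pos {B : Matrix V V ℤ} {p : V} (h : FK B p) {x y : V} (hxy : ¬ 0 < B x y)
    (hne : x ≠ y) : 0 < B y x := (h.total hne).resolve_left hxy

theorem FK.of_QFork {B : Matrix V V ℤ} {p : V} (hskew : ∀ i j, B j i = -B i j)
    (h : QFork B p) : FK B p := by
  obtain ⟨h1, h2, h3, h4⟩ := h
  have hab : ∀ i j, i ≠ j → 2 ≤ B i j ∨ 2 ≤ B j i := by
    intro i j hij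
    have a := h1 i j hij
    have b := hskew i j
    rw [le_abs] at a
    omega
  have htr : ∀ x y z, x ≠ p → y ≠ p → z ≠ p → 0 < B x y → 0 < B y z → 0 < B x z := by
    intro x y z hx hy hz hxy hyz
    by_contra hxz
    by_cases e : x = z
    · subst e
      have := hskew x y
      omega
    have hzx : 0 < B z x := by
      have := hab x z e
      omega
    apply h3
    refine ⟨x, [y, z], hx, ?_, ?_⟩
    · simp [hy, hz]
    · simp [List.Chain]; exact ⟨hxy, hyz, hzx⟩
  have hii : ∀ x, B x x = 0 := fun x => by have := hskew x x; omega
  -- generic transitivity would make `B` acyclic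
  have key : ∀ R : (∀ x y z, 0 < B x y → 0 < B y z → 0 < B x z), False := by
    intro R
    apply h2
    rintro ⟨x, l, -, -, hc⟩
    have aux : ∀ (l : List V) (x z : V),
        List.IsChain (fun i j => 0 < B i j) (x :: (l ++ [z])) → 0 < B x z := by
      intro l
      induction l with
      | nil => intro x z hc; simpa using hc
      | cons a l ih =>
        intro x z hc
        simp only [List.cons_append, List.isChain_cons_cons] at hc
        exact R x a z hc.1 (ih a z hc.2)
    have := aux l x x hc
    have := hii x
    omega
  refine ⟨hskew, hab, htr, h4, ?_, ?_⟩
  · by_contra hno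
    push Not at hno
    apply key
    intro x y z hxy hyz
    have hy : y ≠ p := by rintro rfl; have := hno x; omega
    have hz : z ≠ p := by rintro rfl; have := hno y; omega
    by_cases hx : x = p
    · subst hx
      have := hab x z (Ne.symm hz)
      have := hno z
      omega
    · exact htr x y z hx hy hz hxy hyz
  · by_contra hno
    push Not at hno
    apply key
    intro x y z hxy hyz
    have hy : y ≠ p := by rintro rfl; have := hno z; omega
    have hx : x ≠ p := by rintro rfl; have := hno y; omega
    by_cases hz : z = p
    · subst hz
      have := hab x z hx
      have := hno x
      omega
    · exact htr x y z hx hy hz hxy hyz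

theorem mutB_left (B : Matrix V V ℤ) (x y : V) : mutB B x x y = - B x y := by
  simp [mutB]

theorem mutB_right (B : Matrix V V ℤ) (x y : V) : mutB B x y x = - B y x := by
  simp [mutB]

/-- entry of the mutation along a path `y → x → z` -/
theorem mutB_path {B : Matrix V V ℤ} {x y z : V} (hy : 0 < B y x) (hz : 0 < B x z)
    (hyx : y ≠ x) (hzx : z ≠ x) : mutB B x y z = B y z + B y x * B x z := by
  have : 0 ≤ B y x * B x z := by positivity
  simp [mutB, hyx, hzx, Int.sign_eq_one_of_pos hy, max_eq_left this]

theorem mutB_path' {B : Matrix V V ℤ} {x y z : V} (hy : B y x < 0) (hz : B x z < 0)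
    (hyx : y ≠ x) (hzx : z ≠ x) : mutB B x y z = B y z - B y x * B x z := by
  have : 0 ≤ B y x * B x z := by nlinarith
  simp [mutB, hyx, hzx, Int.sign_eq_neg_one_of_neg hy, max_eq_left this, sub_eq_add_neg]

theorem mutB_same {B : Matrix V V ℤ} {x y z : V} (h : B y x * B x z ≤ 0)
    (hyx : y ≠ x) (hzx : z ≠ x) : mutB B x y z = B y z := by
  simp [mutB, hyx, hzx, max_eq_right h]

theorem mutB_skew {B : Matrix V V ℤ} (hs : ∀ i j, B j i = -B i j) (x : V) :
    ∀ i j, mutB B x j i = - mutB B x i j := by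
  intro i j
  by_cases hi : i = x
  · subst hi; rw [mutB_left, mutB_right, hs i j]
  by_cases hj : j = x
  · subst hj; rw [mutB_left, mutB_right, hs i j]
  have h1 := hs i x
  have h2 := hs j x
  have h3 := hs i j
  rcases lt_trichotomy (B i x) 0 with a | a | a <;> rcases lt_trichotomy (B j x) 0 with b | b | b
  · rw [mutB_same (by nlinarith) hj hi, mutB_same (by nlinarith) hi hj, h3]
  · rw [mutB_same (by nlinarith) hj hi, mutB_same (by nlinarith) hi hj, h3]
  · rw [mutB_path b (by omega) hj hi, mutB_path' a (by omega) hi hj, h1, h2, h3]; ring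
  · rw [mutB_same (by simp [h1, a]) hj hi, mutB_same (by simp [a]) hi hj, h3]
  · rw [mutB_same (by simp [h1, a]) hj hi, mutB_same (by simp [a]) hi hj, h3]
  · rw [mutB_same (by simp [h1, a]) hj hi, mutB_same (by simp [a]) hi hj, h3]
  · rw [mutB_path' b (by omega) hj hi, mutB_path a (by omega) hi hj, h1, h2, h3]; ring
  · rw [mutB_same (by nlinarith) hj hi, mutB_same (by nlinarith) hi hj, h3]
  · rw [mutB_same (by nlinarith) hj hi, mutB_same (by nlinarith) hi hj, h3]

/-- the strict inequalities along a path `y → x → z` -/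
theorem FK.path {B : Matrix V V ℤ} {p x y z : V} (h : FK B p) (hx : x ≠ p)
    (hy : 0 < B y x) (hz : 0 < B x z) :
    B y x < mutB B x y z ∧ B x z < mutB B x y z := by
  have hii : ∀ x, B x x = 0 := fun x => by have := h.skew x x; omega
  have hyx : y ≠ x := by rintro rfl; have := hii y; omega
  have hzx : z ≠ x := by rintro rfl; have := hii z; omega
  rw [mutB_path hy hz hyx hzx]
  have sx := h.skew y x
  have sz := h.skew x z
  have hy2 : 2 ≤ B y x := by have := h.abd y x hyx; omega
  have hz2 : 2 ≤ B x z := by have := h.abd x z (Ne.symm hzx); omega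
  by_cases hpos : 0 < B y z
  · constructor <;> nlinarith
  have hyz : y ≠ z := by rintro rfl; omega
  have hzy : 0 < B z y := h.of_not_pos hpos hyz
  have syz := h.skew y z
  by_cases e : y = p
  · subst e
    have := h.ineq z x hzy hy
    constructor <;> nlinarith
  by_cases e' : z = p
  · subst e'
    have := h.ineq x y hz hzy
    constructor <;> nlinarith
  exact absurd (h.trans y x z e hx e' hy hz) hpos

theorem FK.keep {B : Matrix V V ℤ} {p x y z : V} (h : FK B p) (hx : x ≠ p)
    (hyp : y ≠ p) (hzp : z ≠ p) (hyx : y ≠ x) (hzx : z ≠ x) (hyz : 0 < B y z) :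
    0 < mutB B x y z := by
  have s1 := h.skew y x
  have s2 := h.skew x z
  have s3 := h.skew y z
  by_cases a : 0 < B y x <;> by_cases b : 0 < B x z
  · have := h.path hx a b; omega
  · rw [mutB_same (by nlinarith) hyx hzx]; exact hyz
  · rw [mutB_same (by nlinarith) hyx hzx]; exact hyz
  · have a' := h.of_not_pos a hyx
    have b' := h.of_not_pos b hzx.symm
    have := h.trans z x y hzp hx hyp b' a'
    omega

theorem FK.source {B : Matrix V V ℤ} {p x : V} (h : FK B p) (hx : x ≠ p)
    (hpx : 0 < B p x) {y : V} (hyp : y ≠ p) (hyx : y ≠ x) : 0 < mutB B x p y := by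
  by_cases b : 0 < B x y
  · have := h.path hx hpx b; omega
  · have b' := h.of_not_pos b hyx.symm
    rw [mutB_same (by nlinarith) hx.symm hyx]
    rcases h.total hyp with a | a
    · have := h.ineq y x a hpx; have := h.skew x y; omega
    · exact a

theorem FK.sink {B : Matrix V V ℤ} {p x : V} (h : FK B p) (hx : x ≠ p)
    (hxp : 0 < B x p) {y : V} (hyp : y ≠ p) (hyx : y ≠ x) : 0 < mutB B x y p := by
  by_cases b : 0 < B y x
  · have := h.path hx b hxp; omega
  · have b' := h.of_not_pos b hyx
    rw [mutB_same (by nlinarith) hyx hx.symm]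
    rcases h.total hyp with a | a
    · exact a
    · have := h.ineq x y hxp a; have := h.skew x y; omega

theorem FK.mut {B : Matrix V V ℤ} {p x : V} (h : FK B p) (hx : x ≠ p) : FK (mutB B x) x := by
  have hs := mutB_skew h.skew x
  have hd : ∀ y z, y ≠ x → z ≠ x → y ≠ p → z ≠ p → (0 < mutB B x y z → 0 < B y z) := by
    intro y z hy hz hyp hzp hpos
    by_cases e : y = z
    · subst e; have := hs y y; omega
    by_contra hn
    have := h.keep hx hzp hyp hz hy (h.of_not_pos hn e)
    have := hs y z
    omega
  refine ⟨hs, ?_, ?_, ?_, ?_, ?_⟩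
  · intro i j hij
    by_cases hi : i = x
    · subst hi; rw [mutB_left, mutB_right]
      have := h.abd i j hij; have := h.skew i j; omega
    by_cases hj : j = x
    · subst hj; rw [mutB_left, mutB_right]
      have := h.abd i j hij; have := h.skew i j; omega
    have a1 := h.abd i x hi
    have a2 := h.abd j x hj
    have s1 := h.skew i x
    have s2 := h.skew j x
    have a3 := h.abd i j hij
    have s3 := hs i j
    have s4 := h.skew i j
    rcases a1 with a1 | a1 <;> rcases a2 with a2 | a2
    · rw [mutB_same (y := i) (z := j) (by nlinarith) hi hj] at *; omega
    · have := h.path hx (y := i) (z := j) (by omega) (by omega); omega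
    · have := h.path hx (y := j) (z := i) (by omega) (by omega); omega
    · rw [mutB_same (y := i) (z := j) (by nlinarith) hi hj] at *; omega
  · intro a b c ha hb hc hab hbc
    have hac : a ≠ c := by rintro rfl; have := hs a b; omega
    have hab' : a ≠ b := by rintro rfl; have := hs a a; omega
    have hbc' : b ≠ c := by rintro rfl; have := hs b b; omega
    rcases h.total hx with hp | hp
    · have S := fun y => h.sink hx hp (y := y)
      by_cases e : a = p
      · subst e; have := S b hab'.symm hb; have := hs a b; omega
      by_cases e : b = p
      · subst e; have := S c hbc'.symm hc; have := hs b c; omega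
      by_cases e : c = p
      · subst e; exact S a ‹_› ha
      exact h.keep hx ‹_› ‹_› ha hc (h.trans a b c ‹_› ‹_› ‹_› (hd _ _ ha hb ‹_› ‹_› hab)
        (hd _ _ hb hc ‹_› ‹_› hbc))
    · have S := fun y => h.source hx hp (y := y)
      by_cases e : c = p
      · subst e; have := S b hbc' hb; have := hs b c; omega
      by_cases e : b = p
      · subst e; have := S a hab' ha; have := hs a b; omega
      by_cases e : a = p
      · subst e; exact S c ‹_› hc
      exact h.keep hx ‹_› ‹_› ha hc (h.trans a b c ‹_› ‹_› ‹_› (hd _ _ ha hb ‹_› ‹_› hab)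
        (hd _ _ hb hc ‹_› ‹_› hbc))
  · intro i j hi hj
    rw [mutB_right] at hi
    rw [mutB_left] at hj
    have s1 := h.skew i x
    have s2 := h.skew x j
    have := h.path hx (y := j) (z := i) (by omega) (by omega)
    rw [mutB_right, mutB_left]; omega
  · rcases h.total hx with hp | hp
    · exact ⟨p, by rw [mutB_right]; have := h.skew x p; omega⟩
    · obtain ⟨i, hi⟩ := h.hin
      have := h.ineq i x hi hp
      exact ⟨i, by rw [mutB_right]; have := h.skew x i; omega⟩
  · rcases h.total hx with hp | hp
    · obtain ⟨j, hj⟩ := h.hout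
      have := h.ineq x j hp hj
      exact ⟨j, by rw [mutB_left]; have := h.skew x j; omega⟩
    · exact ⟨p, by rw [mutB_left]; have := h.skew x p; omega⟩

/-! Colours. -/

theorem SSC.mut {P : Matrix V V ℤ × Matrix V W ℤ} (h : SSC P) (x : V) : SSC (mutPair P x) :=
  fun w i => h (x :: w) i

theorem SSC.red_of_nonpos {P : Matrix V V ℤ × Matrix V W ℤ} (h : SSC P) {i : V}
    (hi : ∀ t, P.2 i t ≤ 0) : QRed P.2 i := by
  rcases h [] i with h1 | h1
  · exact h1
  · exact ⟨hi, h1.2⟩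

theorem SSC.green_of_nonneg {P : Matrix V V ℤ × Matrix V W ℤ} (h : SSC P) {i : V}
    (hi : ∀ t, 0 ≤ P.2 i t) : QGreen P.2 i := by
  rcases h [] i with h1 | h1
  · exact ⟨hi, h1.2⟩
  · exact h1

theorem mutC_self (B : Matrix V V ℤ) (C : Matrix V W ℤ) (x : V) (t : W) :
    mutC B C x x t = - C x t := by simp [mutC]

theorem mutC_green_ge {B : Matrix V V ℤ} {C : Matrix V W ℤ} {x y : V} (hx : QGreen C x)
    (hyx : y ≠ x) (hB : 0 < B y x) (t : W) : mutC B C x y t = C y t + B y x * C x t := by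
  have := hx.1 t
  have : 0 ≤ B y x * C x t := by positivity
  simp [mutC, hyx, Int.sign_eq_one_of_pos hB, max_eq_left this]

theorem mutC_green_le {B : Matrix V V ℤ} {C : Matrix V W ℤ} {x y : V} (hx : QGreen C x)
    (hyx : y ≠ x) (hB : B y x ≤ 0) (t : W) : mutC B C x y t = C y t := by
  have := hx.1 t
  have : B y x * C x t ≤ 0 := by nlinarith
  simp [mutC, hyx, max_eq_right this]

theorem mutC_red_ge {B : Matrix V V ℤ} {C : Matrix V W ℤ} {x y : V} (hx : QRed C x)
    (hyx : y ≠ x) (hB : 0 ≤ B y x) (t : W) : mutC B C x y t = C y t := by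
  have := hx.1 t
  have : B y x * C x t ≤ 0 := by nlinarith
  simp [mutC, hyx, max_eq_right this]

theorem mutC_red_lt {B : Matrix V V ℤ} {C : Matrix V W ℤ} {x y : V} (hx : QRed C x)
    (hyx : y ≠ x) (hB : B y x < 0) (t : W) : mutC B C x y t = C y t - B y x * C x t := by
  have := hx.1 t
  have : 0 ≤ B y x * C x t := by nlinarith
  simp [mutC, hyx, Int.sign_eq_neg_one_of_neg hB, max_eq_left this, sub_eq_add_neg]

/-- mutating at a green vertex makes it red -/
theorem red_self {B : Matrix V V ℤ} {C : Matrix V W ℤ} {x : V} (hx : QGreen C x) :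
    QRed (mutC B C x) x := by
  have e : mutC B C x x = - C x := funext (mutC_self B C x)
  refine ⟨fun t => ?_, ?_⟩
  · rw [mutC_self]; have := hx.1 t; omega
  · rw [e]; simpa using hx.2

theorem green_self {B : Matrix V V ℤ} {C : Matrix V W ℤ} {x : V} (hx : QRed C x) :
    QGreen (mutC B C x) x := by
  have e : mutC B C x x = - C x := funext (mutC_self B C x)
  refine ⟨fun t => ?_, ?_⟩
  · rw [mutC_self]; have := hx.1 t; omega
  · rw [e]; simpa using hx.2

theorem row_green_le {B : Matrix V V ℤ} {C : Matrix V W ℤ} {x y : V} (hx : QGreen C x)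
    (hyx : y ≠ x) (hB : B y x ≤ 0) : mutC B C x y = C y := funext (mutC_green_le hx hyx hB)

theorem row_red_ge {B : Matrix V V ℤ} {C : Matrix V W ℤ} {x y : V} (hx : QRed C x)
    (hyx : y ≠ x) (hB : 0 ≤ B y x) : mutC B C x y = C y := funext (mutC_red_ge hx hyx hB)

theorem QRed.congr_row {C C' : Matrix V W ℤ} {i : V} (h : QRed C i) (e : C' i = C i) :
    QRed C' i := by
  unfold QRed; rw [e]; exact h

theorem QGreen.congr_row {C C' : Matrix V W ℤ} {i : V} (h : QGreen C i) (e : C' i = C i) :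
    QGreen C' i := by
  unfold QGreen; rw [e]; exact h

/-- green stays green under a green mutation elsewhere -/
theorem green_green {P : Matrix V V ℤ × Matrix V W ℤ} (h : SSC P) {x y : V}
    (hx : QGreen P.2 x) (hy : QGreen P.2 y) (hyx : y ≠ x) : QGreen (mutPair P x).2 y := by
  apply (h.mut x).green_of_nonneg
  intro t
  have a := hx.1 t
  have b := hy.1 t
  by_cases hB : 0 < P.1 y x
  · change 0 ≤ mutC P.1 P.2 x y t
    rw [mutC_green_ge hx hyx hB]; positivity
  · change 0 ≤ mutC P.1 P.2 x y t
    rw [mutC_green_le hx hyx (by omega)]; exact b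

/-- red stays red under a red mutation elsewhere -/
theorem red_red {P : Matrix V V ℤ × Matrix V W ℤ} (h : SSC P) {x y : V}
    (hx : QRed P.2 x) (hy : QRed P.2 y) (hyx : y ≠ x) : QRed (mutPair P x).2 y := by
  apply (h.mut x).red_of_nonpos
  intro t
  have a := hx.1 t
  have b := hy.1 t
  by_cases hB : P.1 y x < 0
  · change mutC P.1 P.2 x y t ≤ 0
    rw [mutC_red_lt hx hyx hB]; nlinarith
  · change mutC P.1 P.2 x y t ≤ 0
    rw [mutC_red_ge hx hyx (by omega)]; exact b

/-- If `i` is red, `k` is green, `i → k`, and mutating at `i` leaves `k` green, then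
mutating at `k` makes `i` green. -/
theorem swap_green {P : Matrix V V ℤ × Matrix V W ℤ} (h : SSC P) {i k : V}
    (hs : P.1 k i = - P.1 i k)
    (hi : QRed P.2 i) (hk : QGreen P.2 k) (hne : i ≠ k) (hB : 0 < P.1 i k)
    (hg : QGreen (mutPair P i).2 k) : QGreen (mutPair P k).2 i := by
  apply (h.mut k).green_of_nonneg
  intro t
  have a : 0 ≤ mutC P.1 P.2 i k t := hg.1 t
  rw [mutC_red_lt hi hne.symm (by omega)] at a
  change 0 ≤ mutC P.1 P.2 k i t
  rw [mutC_green_ge hk hne hB]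
  have h1 := hi.1 t
  have h2 := hk.1 t
  rw [hs] at a
  nlinarith

theorem sweep : ∀ (l : List V) (P : Matrix V V ℤ × Matrix V W ℤ) (p z : V),
    FK P.1 p → p ∉ l → z ∉ l → (∀ a ∈ l, QGreen P.2 a) →
    (∀ y, y ≠ z → y ∉ l → QRed P.2 y) →
    (∀ a ∈ l, ∀ y, y ≠ z → y ∉ l → 0 < P.1 a y) →
    l.Pairwise (fun a b => 0 < P.1 a b) →
    ∃ p', FK (mutSeqPair P l).1 p' ∧ ∀ y, y ≠ z → QRed (mutSeqPair P l).2 y := by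
  intro l
  induction l with
  | nil =>
    intro P p z hF _ _ _ hr _ _
    exact ⟨p, hF, fun y hy => hr y hy (by simp)⟩
  | cons a l ih =>
    intro P p z hF hp hz hg hr hB hpw
    rw [List.pairwise_cons] at hpw
    have hap : a ≠ p := fun e => hp (by simp [e])
    have haz : a ≠ z := fun e => hz (by simp [e])
    have hal : a ∉ l := by
      intro hh; have := hpw.1 a hh; have := hF.skew a a; omega
    have hga := hg a (by simp)
    have hout : ∀ y, y ≠ z → y ≠ a → 0 < P.1 a y := by
      intro y hyz hya
      by_cases hy : y ∈ l
      · exact hpw.1 y hy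
      · exact hB a (by simp) y hyz (by simp [hya, hy])
    have hrow : ∀ y, y ≠ z → y ≠ a → (mutPair P a).2 y = P.2 y := by
      intro y hyz hya
      apply row_green_le hga hya
      have := hout y hyz hya
      have := hF.skew a y
      omega
    have hBB : ∀ x y, x ≠ z → x ≠ a → y ≠ z → y ≠ a → (mutPair P a).1 x y = P.1 x y := by
      intro x y hxz hxa hyz hya
      apply mutB_same _ hxa hya
      have := hout x hxz hxa
      have := hout y hyz hya
      have := hF.skew a x
      nlinarith
    have hlne : ∀ b ∈ l, b ≠ a ∧ b ≠ z := by
      intro b hb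
      exact ⟨fun e => hal (e ▸ hb), fun e => hz (by simp [← e, hb])⟩
    have := ih (mutPair P a) a z (hF.mut hap) hal (fun hh => hz (by simp [hh])) ?_ ?_ ?_ ?_
    · exact this
    · intro b hb
      have := hlne b hb
      exact (hg b (by simp [hb])).congr_row (hrow b this.2 this.1)
    · intro y hyz hyl
      by_cases e : y = a
      · subst e; exact red_self hga
      · exact (hr y hyz (by simp [e, hyl])).congr_row (hrow y hyz e)
    · intro b hb y hyz hyl
      have hb' := hlne b hb
      by_cases e : y = a
      · subst e
        change 0 < mutB P.1 y b y
        rw [mutB_right]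
        have := hpw.1 b hb
        have := hF.skew y b
        omega
      · rw [hBB b y hb'.2 hb'.1 hyz e]
        exact hB b (by simp [hb]) y hyz (by simp [e, hyl])
    · refine hpw.2.imp_of_mem ?_
      intro b c hb hc hbc
      rw [hBB b c (hlne b hb).2 (hlne b hb).1 (hlne c hc).2 (hlne c hc).1]
      exact hbc

/-- If mutating at a red `x` with `r → x` leaves only `r` and `x` green, the mutation
sequence `x, r` finishes. -/
theorem two_step {P : Matrix V V ℤ × Matrix V W ℤ} {r x : V}
    (hF : FK P.1 r) (hxr : x ≠ r) (hrx : 0 < P.1 r x) (hgr : QGreen P.2 r) (hx : QRed P.2 x)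
    (hred : ∀ y, y ≠ r → y ≠ x → QRed (mutPair P x).2 y) :
    ∃ p', FK (mutSeqPair P [x, r]).1 p' ∧ ∀ y, y ≠ x → QRed (mutSeqPair P [x, r]).2 y := by
  refine sweep [r] (mutPair P x) x x (hF.mut hxr) (by simp [hxr]) (by simp [hxr]) ?_ ?_ ?_
    (by simp)
  · intro a ha
    obtain rfl : a = r := by simpa using ha
    exact hgr.congr_row (row_red_ge hx hxr.symm hrx.le)
  · intro y hy hy'
    exact hred y (by simpa using hy') hy
  · intro a ha y hy hy'
    obtain rfl : a = r := by simpa using ha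
    exact hF.source hxr hrx (by simpa using hy') hy

end Helpers

theorem finish {n m : ℕ} {P : Matrix (Fin n) (Fin n) ℤ × Matrix (Fin n) (Fin m) ℤ}
    {w : List (Fin n)} {N : ℕ} (hw : w.length ≤ N) (z : Fin n)
    (h : ∃ p', FK (mutSeqPair P w).1 p' ∧ ∀ y, y ≠ z → QRed (mutSeqPair P w).2 y) :
    ∃ w : List (Fin n), w.length ≤ N ∧
      ∃ r' : Fin n, QFork (mutSeqPair P w).1 r' ∧
        n - 1 ≤ {i : Fin n | QRed (mutSeqPair P w).2 i}.ncard := by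
  obtain ⟨p', hF, hr⟩ := h
  refine ⟨w, hw, p', hF.toQFork, ?_⟩
  have h1 : ({z}ᶜ : Set (Fin n)).ncard = n - 1 := by
    rw [Set.ncard_compl]; simp
  rw [← h1]
  exact Set.ncard_le_ncard (fun y hy => hr y hy) (Set.toFinite _)

/-- Lemma `lem-green-por-2-green`. -/
theorem green_por_two_green {n m : ℕ}
    (B : Matrix (Fin n) (Fin n) ℤ) (C : Matrix (Fin n) (Fin m) ℤ)
    (hskew : ∀ i j, B j i = -B i j)
    (r : Fin n) (hfork : QFork B r)
    (hssc : SSC (B, C))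
    (v : Fin (n - 1) → Fin n) (hner : ∀ i, v i ≠ r)
    (henum : ∀ u, u ≠ r → ∃ i, u = v i)
    (hord : ∀ i j : Fin (n - 1), i < j → 0 < B (v i) (v j))
    (j : Fin (n - 1))
    (hgr : QGreen C r) (hgj : QGreen C (v j))
    (hrest : ∀ u : Fin n, u ≠ r → u ≠ v j → QRed C u) :
    ∃ w : List (Fin n), w.length ≤ j.1 + 3 ∧
      ∃ r' : Fin n, QFork (mutSeqPair (B, C) w).1 r' ∧
        n - 1 ≤ {i : Fin n | QRed (mutSeqPair (B, C) w).2 i}.ncard := by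
  have hF : FK B r := FK.of_QFork hskew hfork
  have hinj : ∀ a b, v a = v b → a = b := by
    intro a b e
    by_contra hne
    have hii : B (v b) (v b) = 0 := by have := hskew (v b) (v b); omega
    rcases lt_or_gt_of_ne hne with h | h
    · have := hord a b h; rw [e] at this; omega
    · have := hord b a h; rw [e] at this; omega
  have hne : ∀ {a b}, a ≠ b → v a ≠ v b := fun h e => h (hinj _ _ e)
  have hlt : ∀ {a b}, 0 < B (v a) (v b) → a < b := by
    intro a b hab
    by_contra hn
    rcases (not_lt.1 hn).eq_or_lt with h | h
    · subst h; have := hskew (v b) (v b); omega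
    · have := hord b a h; have := hskew (v a) (v b); omega
  -- the list of the vertices before `v j`
  let l : List (Fin n) := List.ofFn (fun i : Fin j.1 => v ⟨i.1, by omega⟩)
  have hlen : l.length = j.1 := by simp [l]
  have hmem : ∀ y, y ∈ l ↔ ∃ i, i < j ∧ y = v i := by
    intro y
    simp only [l, List.mem_ofFn]
    constructor
    · rintro ⟨i, rfl⟩
      exact ⟨_, Fin.lt_def.2 i.2, rfl⟩
    · rintro ⟨i, hi, rfl⟩
      exact ⟨⟨i.1, hi⟩, rfl⟩
  have hlpw : ∀ R : Fin n → Fin n → Prop, (∀ a b, a < b → b < j → R (v a) (v b)) →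
      l.Pairwise R := by
    intro R hR
    simp only [l, List.pairwise_ofFn]
    intro a b hab
    exact hR _ _ (Fin.lt_def.2 hab) (Fin.lt_def.2 b.2)
  have hjl : v j ∉ l := by
    rw [hmem]; rintro ⟨i, hi, e⟩; have := hinj _ _ e; omega
  have hrl : r ∉ l := by
    rw [hmem]; rintro ⟨i, hi, e⟩; exact hner i e.symm
  have hnl : ∀ y, y ≠ r → y ≠ v j → y ∉ l → ∃ k, j < k ∧ y = v k := by
    intro y h1 h2 h3
    obtain ⟨k, rfl⟩ := henum y h1
    refine ⟨k, ?_, rfl⟩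
    by_contra hk
    rcases (not_lt.1 hk).eq_or_lt with h | h
    · exact h2 (by rw [h])
    · exact h3 ((hmem _).2 ⟨k, h, rfl⟩)
  -- the two-step finish
  have htwo : ∀ i, i ≠ j → 0 < B r (v i) → QRed (mutPair (B, C) (v i)).2 (v j) →
      ∃ w : List (Fin n), w.length ≤ j.1 + 3 ∧
      ∃ r' : Fin n, QFork (mutSeqPair (B, C) w).1 r' ∧
        n - 1 ≤ {i : Fin n | QRed (mutSeqPair (B, C) w).2 i}.ncard := by
    intro i hij hri hred
    have hxi : QRed C (v i) := hrest _ (hner i) (hne hij)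
    refine finish (w := [v i, r]) (by simp) (v i)
      (two_step (P := (B, C)) hF (hner i) hri hgr hxi ?_)
    intro y hyr hyi
    by_cases e : y = v j
    · rw [e]; exact hred
    · exact red_red hssc (P := (B, C)) hxi (hrest y hyr e) hyi
  rcases hF.total (hner j).symm with hrj | hjr
  · -- `r → v j`
    by_cases hex : ∃ i, i < j ∧ QRed (mutPair (B, C) (v i)).2 (v j)
    · obtain ⟨i, hi, hred⟩ := hex
      refine htwo i hi.ne ?_ hred
      by_contra hn
      have h1 := hF.of_not_pos hn (hner i).symm
      have h2 := hF.ineq _ _ h1 hrj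
      have := hlt (show 0 < B (v j) (v i) by omega)
      omega
    · push Not at hex
      refine finish (w := v j :: r :: l) (by simp [hlen]) (v j)
        (sweep (r :: l) (mutPair (B, C) (v j)) (v j) (v j) (hF.mut (hner j)) ?_ ?_ ?_ ?_ ?_ ?_)
      · simp [hner j, hjl]
      · simp [hner j, hjl]
      · intro a ha
        rcases List.mem_cons.1 ha with rfl | ha
        · exact green_green hssc (P := (B, C)) hgj hgr (hner j).symm
        · obtain ⟨i, hi, rfl⟩ := (hmem a).1 ha
          exact swap_green (P := (B, C)) hssc (hskew _ _) (hrest _ (hner i) (hne hi.ne)) hgj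
            (hne hi.ne) (hord i j hi)
            ((hssc [v i] (v j)).resolve_left (hex i hi))
      · intro y hyj hyl
        simp only [List.mem_cons, not_or] at hyl
        obtain ⟨k, hk, rfl⟩ := hnl y hyl.1 hyj hyl.2
        refine (hrest (v k) hyl.1 hyj).congr_row (row_green_le hgj hyj ?_)
        have := hord j k hk
        have := hskew (v j) (v k)
        change B (v k) (v j) ≤ 0
        omega
      · intro a ha y hyj hyl
        simp only [List.mem_cons, not_or] at hyl
        rcases List.mem_cons.1 ha with rfl | ha
        · exact hF.source (hner j) hrj hyl.1 hyj
        · obtain ⟨i, hi, rfl⟩ := (hmem a).1 ha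
          obtain ⟨k, hk, rfl⟩ := hnl y hyl.1 hyj hyl.2
          exact hF.keep (hner j) (hner i) (hner k) (hne hi.ne) hyj (hord i k (hi.trans hk))
      · rw [List.pairwise_cons]
        constructor
        · intro a ha
          obtain ⟨i, hi, rfl⟩ := (hmem a).1 ha
          exact hF.source (hner j) hrj (hner i) (hne hi.ne)
        · apply hlpw
          intro a b hab hb
          exact hF.keep (hner j) (hner a) (hner b) (hne (hab.trans hb).ne) (hne hb.ne)
            (hord a b hab)
  · -- `v j → r`
    obtain ⟨o, ho⟩ := hF.hout
    have hor : o ≠ r := by rintro rfl; have := hskew o o; omega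
    obtain ⟨s, rfl⟩ := henum o hor
    have hsj : s < j := hlt (by have := hF.ineq _ _ hjr ho; omega)
    obtain ⟨z, hz⟩ : ∃ z : Fin (n - 1), z.1 = 0 := ⟨⟨0, by omega⟩, rfl⟩
    have hzlt : ∀ i, i ≠ z → z < i := by
      intro i hi
      have : i.1 ≠ z.1 := fun e => hi (Fin.ext e)
      exact Fin.lt_def.2 (by omega)
    have hzj : z < j := by rw [Fin.lt_def] at *; omega
    have hrz : 0 < B r (v z) := by
      by_contra hn
      have h1 := hF.of_not_pos hn (hner z).symm
      have h2 := hF.ineq _ _ h1 ho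
      have h3 := hlt (show 0 < B (v s) (v z) by omega)
      rw [Fin.lt_def] at h3; omega
    rcases hssc [v z] (v j) with hred | hgj1
    · exact htwo z hzj.ne hrz hred
    -- first mutation
    have hzred : QRed C (v z) := hrest _ (hner z) (hne hzj.ne)
    obtain ⟨P1, hP1⟩ : ∃ P1, P1 = mutPair (B, C) (v z) := ⟨_, rfl⟩
    replace hgj1 : QGreen P1.2 (v j) := by rw [hP1]; exact hgj1
    have hs1 : SSC P1 := by rw [hP1]; exact hssc.mut _
    have hF1 : FK P1.1 (v z) := by rw [hP1]; exact hF.mut (hner z)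
    have hz1 : QGreen P1.2 (v z) := by rw [hP1]; exact green_self hzred
    have hr1 : QGreen P1.2 r := by
      rw [hP1]; exact hgr.congr_row (row_red_ge hzred (hner z).symm hrz.le)
    have hi1 : ∀ i, i ≠ z → i ≠ j → QRed P1.2 (v i) := by
      intro i hiz hij
      rw [hP1]
      exact red_red (P := (B, C)) hssc hzred (hrest _ (hner i) (hne hij)) (hne hiz)
    have hBr1 : ∀ i, i ≠ z → 0 < P1.1 r (v i) := by
      intro i hi
      rw [hP1]; exact hF.source (hner z) hrz (hner i) (hne hi)
    have hBzr1 : 0 < P1.1 (v z) r := by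
      rw [hP1]; change 0 < mutB B (v z) (v z) r
      rw [mutB_left]; have := hskew (v z) r; omega
    have hB1 : ∀ i k, i ≠ z → k ≠ z → i < k → 0 < P1.1 (v i) (v k) := by
      intro i k hi hk hik
      rw [hP1]; exact hF.keep (hner z) (hner i) (hner k) (hne hi) (hne hk) (hord i k hik)
    -- second mutation
    obtain ⟨P2, hP2⟩ : ∃ P2, P2 = mutPair P1 r := ⟨_, rfl⟩
    have hs2 : SSC P2 := by rw [hP2]; exact hs1.mut _
    have hF2 : FK P2.1 r := by rw [hP2]; exact hF1.mut (hner z).symm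
    have hr2 : QRed P2.2 r := by rw [hP2]; exact red_self hr1
    have hz2 : QGreen P2.2 (v z) := by rw [hP2]; exact green_green hs1 hr1 hz1 (hner z)
    have hrow2 : ∀ i, i ≠ z → P2.2 (v i) = P1.2 (v i) := by
      intro i hi
      rw [hP2]
      refine row_green_le hr1 (hner i) ?_
      have := hBr1 i hi; have := hF1.skew r (v i); omega
    have hi2 : ∀ i, i ≠ z → i ≠ j → QRed P2.2 (v i) := fun i hi hij =>
      (hi1 i hi hij).congr_row (hrow2 i hi)
    have hj2 : QGreen P2.2 (v j) := hgj1.congr_row (hrow2 j hzj.ne')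
    have hBr2 : ∀ i, i ≠ z → 0 < P2.1 (v i) r := by
      intro i hi
      rw [hP2]; change 0 < mutB P1.1 r (v i) r
      rw [mutB_right]; have := hBr1 i hi; have := hF1.skew r (v i); omega
    have hB2 : ∀ i k, i < k → 0 < P2.1 (v i) (v k) := by
      intro i k hik
      have hk : k ≠ z := by rintro rfl; rw [Fin.lt_def] at hik; omega
      rw [hP2]
      by_cases hi : i = z
      · subst hi
        exact hF1.source (hner i).symm hBzr1 (hne hk) (hner k)
      · exact hF1.keep (hner z).symm (hne hi) (hne hk) (hner i) (hner k) (hB1 i k hi hk hik)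
    have hcat : ∀ w, mutSeqPair (B, C) (v z :: r :: w) = mutSeqPair P2 w := by
      intro w; rw [hP2, hP1]; rfl
    by_cases hex : ∃ i, i ≠ z ∧ i < j ∧ QRed (mutPair P2 (v i)).2 (v j)
    · obtain ⟨i, hiz, hij, hred⟩ := hex
      have hxi := hi2 i hiz hij.ne
      refine finish (w := v z :: r :: [v i, v z]) ?_ (v i) ?_
      · simp only [List.length_cons, List.length_nil]; rw [Fin.lt_def] at hzj; omega
      rw [hcat]
      refine sweep [v z] (mutPair P2 (v i)) (v i) (v i) (hF2.mut (hner i))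
        (by simpa using hne hiz) (by simpa using hne hiz) ?_ ?_ ?_ (by simp)
      · intro a ha
        obtain rfl : a = v z := by simpa using ha
        exact hz2.congr_row (row_red_ge hxi (hne hiz.symm) (hB2 z i (hzlt i hiz)).le)
      · intro y hyi hyz
        replace hyz : y ≠ v z := by simpa using hyz
        by_cases e : y = r
        · subst e; exact red_red hs2 hxi hr2 hyi
        obtain ⟨k, rfl⟩ := henum y e
        by_cases e' : k = j
        · subst e'; exact hred
        · exact red_red hs2 hxi (hi2 k (fun h => hyz (by rw [h])) e') hyi
      · intro a ha y hyi hyz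
        obtain rfl : a = v z := by simpa using ha
        replace hyz : y ≠ v z := by simpa using hyz
        by_cases e : y = r
        · subst e; exact hF2.sink (hner i) (hBr2 i hiz) (hner z) (hne hiz.symm)
        obtain ⟨k, rfl⟩ := henum y e
        exact hF2.keep (hner i) (hner z) (hner k) (hne hiz.symm) hyi
          (hB2 z k (hzlt k (fun h => hyz (by rw [h]))))
    · push Not at hex
      refine finish (w := v z :: r :: v j :: l) ?_ (v j) ?_
      · simp [hlen]
      rw [hcat]
      refine sweep l (mutPair P2 (v j)) (v j) (v j) (hF2.mut (hner j)) hjl hjl ?_ ?_ ?_ ?_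
      · intro a ha
        obtain ⟨i, hi, rfl⟩ := (hmem a).1 ha
        by_cases e : i = z
        · subst e; exact green_green hs2 hj2 hz2 (hne hi.ne)
        · exact swap_green hs2 (hF2.skew _ _) (hi2 i e hi.ne) hj2 (hne hi.ne) (hB2 i j hi)
            ((hs2 [v i] (v j)).resolve_left (hex i e hi))
      · intro y hyj hyl
        by_cases e : y = r
        · subst e
          refine hr2.congr_row (row_green_le hj2 hyj ?_)
          have := hBr2 j hzj.ne'; have := hF2.skew (v j) y; omega
        obtain ⟨k, hk, rfl⟩ := hnl y e hyj hyl
        refine (hi2 k (hzj.trans hk).ne' hk.ne').congr_row (row_green_le hj2 hyj ?_)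
        have := hB2 j k hk; have := hF2.skew (v j) (v k); omega
      · intro a ha y hyj hyl
        obtain ⟨i, hi, rfl⟩ := (hmem a).1 ha
        by_cases e : y = r
        · subst e; exact hF2.sink (hner j) (hBr2 j hzj.ne') (hner i) (hne hi.ne)
        obtain ⟨k, hk, rfl⟩ := hnl y e hyj hyl
        exact hF2.keep (hner j) (hner i) (hner k) (hne hi.ne) hyj (hB2 i k (hi.trans hk))
      · apply hlpw
        intro a b hab hb
        exact hF2.keep (hner j) (hner a) (hner b) (hne (hab.trans hb).ne) (hne hb.ne)
          (hB2 a b hab)
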